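/- Let L be a finite-dimensional p-nilpotent restricted Lie algebra over a perfect field F of characteristic p > 0, and let H be a restricted Lie algebra over F with u(L) ≅ u(H) as F-algebras. Then L/L'_p ≅ H/H'_p as restricted Lie algebras (i.e. the quotient L/L'_p is determined by u(L)). -/

import Mathlib

open UniversalEnvelopingAlgebra

attribute [local instance 100] LieRing.ofAssociativeRing

/-- A restricted Lie algebra over a field `F` of characteristic `p`: a Lie algebra equipped
with a `p`-map `x ↦ x^[p]` satisfying Jacobson's identities.  The additive identity
`(x+y)^[p] = x^[p] + y^[p] + Σ sᵢ(x,y)` (with `sᵢ` the Jacobson polynomials) is expressed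
faithfully inside the universal enveloping algebra, where it reads
`ι((x+y)^[p]) - ι(x^[p]) - ι(y^[p]) = (ι x + ι y)^p - (ι x)^p - (ι y)^p`. -/
class RestrictedLieAlgebra (p : ℕ) (F : Type*) (L : Type*) [Field F]
    [LieRing L] [LieAlgebra F L] : Type _ where
  pOp : L → L
  pOp_smul : ∀ (a : F) (x : L), pOp (a • x) = a ^ p • pOp x
  ad_pOp : ∀ x y : L, ⁅pOp x, y⁆ = ((LieAlgebra.ad F L x) ^ p) y
  pOp_add : ∀ x y : L,
    ι F (pOp (x + y)) - ι F (pOp x) - ι F (pOp y)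
      = (ι F x + ι F y) ^ p - (ι F x) ^ p - (ι F y) ^ p

namespace RestrictedLieAlgebra

variable (p : ℕ) (F : Type*) [Field F]

section Defs

variable (L : Type*) [LieRing L] [LieAlgebra F L] [RestrictedLieAlgebra p F L]

/-- The `p`-map of a restricted Lie algebra. -/
abbrev pmap (x : L) : L := RestrictedLieAlgebra.pOp (p := p) (F := F) x

/-- The relation defining the restricted enveloping algebra as a quotient of the
universal enveloping algebra: `x^p = x^[p]` for all `x ∈ L`. -/
def uRel : UniversalEnvelopingAlgebra F L → UniversalEnvelopingAlgebra F L → Prop :=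
  fun a b => ∃ x : L, a = (ι F x) ^ p ∧ b = ι F (pmap p F L x)

/-- The restricted enveloping algebra `u(L)`: the quotient of the universal enveloping
algebra of `L` by the two-sided ideal generated by `{x^p - x^[p] : x ∈ L}`. -/
abbrev uEnv := RingQuot (uRel p F L)

/-- The canonical (linear) embedding `L → u(L)`. -/
def uemb : L →ₗ[F] uEnv p F L :=
  ((RingQuot.mkAlgHom F (uRel p F L)).toLinearMap).comp (ι F : L →ₗ⁅F⁆ _).toLinearMap

variable [Fact p.Prime]

/-- The augmentation map `ε : u(L) → F`, induced by `x ↦ 0` for `x ∈ L`. -/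
noncomputable def aug : uEnv p F L →ₐ[F] F :=
  RingQuot.liftAlgHom F
    ⟨(UniversalEnvelopingAlgebra.lift F) (0 : L →ₗ⁅F⁆ F), by
      rintro a b ⟨x, rfl, rfl⟩
      simp [UniversalEnvelopingAlgebra.lift_ι_apply,
        zero_pow (Nat.Prime.ne_zero (Fact.out : p.Prime))]⟩

/-- The augmentation ideal `ω(L)`, i.e. the kernel of the augmentation map, as a
subspace of `u(L)`. -/
noncomputable def omegaIdeal : Submodule F (uEnv p F L) :=
  LinearMap.ker (aug p F L).toLinearMap

/-- The image of `L` inside `u(L)`. -/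
def lSub : Submodule F (uEnv p F L) := LinearMap.range (uemb p F L)

end Defs

section Closure

variable {L : Type*} [LieRing L] [LieAlgebra F L] [RestrictedLieAlgebra p F L]

/-- The restricted subalgebra generated by a subset `S` of `L`: the smallest Lie
subalgebra containing `S` which is closed under the `p`-map. -/
def restrictedClosure (S : Set L) : LieSubalgebra F L :=
  sInf {K : LieSubalgebra F L | S ⊆ K ∧ ∀ x ∈ K, pmap p F L x ∈ K}

/-- For a subalgebra `N ⊆ L`, the restricted subalgebra `N^p` generated by all
`x^[p]`, `x ∈ N`. -/
def subPPow (K : LieSubalgebra F L) : LieSubalgebra F L :=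
  restrictedClosure p F (pmap p F L '' K)

end Closure

section PNilpotent

variable (L : Type*) [LieRing L] [LieAlgebra F L] [RestrictedLieAlgebra p F L]

/-- `L` is `p`-nilpotent if `L^{pˢ} = 0` for some `s`, where `L^p` denotes the restricted
subalgebra generated by all `x^[p]`. -/
def IsPNilpotent : Prop :=
  ∃ s : ℕ, (subPPow p F)^[s] (⊤ : LieSubalgebra F L) = ⊥

/-- The derived subalgebra `L' = γ₂(L)` as a submodule of `L`. -/
abbrev derivedSub : Submodule F L := (LieModule.lowerCentralSeries F L L 1).toSubmodule

/-- `L'_p`, the restricted subalgebra generated by `L'`, as a submodule. -/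
def derivedP : Submodule F L :=
  (restrictedClosure p F (derivedSub F L : Set L)).toSubmodule

/-- `L'^p + γ₃(L)`, as a submodule of `L`. -/
def mainIdeal : Submodule F L :=
  (subPPow p F (restrictedClosure p F (derivedSub F L : Set L))).toSubmodule
    ⊔ (LieModule.lowerCentralSeries F L L 2).toSubmodule

end PNilpotent

end RestrictedLieAlgebra

namespace FrobeniusModule

section Iterate

variable {p : ℕ} {F : Type*} [Field F] [Fact p.Prime] [CharP F p]
  {A : Type*} [AddCommGroup A] [Module F A] (f : A →ₛₗ[frobenius F p] A)

theorem iterate_smul (k : ℕ) (c : F) (x : A) : f^[k] (c • x) = c ^ p ^ k • f^[k] x := by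
  induction k with
  | zero => simp
  | succ k ih =>
    rw [Function.iterate_succ_apply', ih, map_smulₛₗ, Function.iterate_succ_apply', frobenius_def,
      ← pow_mul, pow_succ]

theorem iterate_sum {ι : Type*} (k : ℕ) (s : Finset ι) (v : ι → A) :
    f^[k] (∑ i ∈ s, v i) = ∑ i ∈ s, f^[k] (v i) := by
  induction k with
  | zero => simp
  | succ k ih => simp only [Function.iterate_succ_apply', ih, map_sum]

theorem iterate_eq_zero_of_le {k m : ℕ} (hkm : k ≤ m) {x : A} (hx : f^[k] x = 0) :
    f^[m] x = 0 := by
  obtain ⟨d, rfl⟩ := Nat.exists_eq_add_of_le' hkm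
  rw [Function.iterate_add_apply, hx, iterate_map_zero]

/-- The Frobenius-semilinear shift on `F^(n+1)`. -/
def shift (p : ℕ) {n : ℕ} (c : Fin (n + 1) → F) : Fin (n + 1) → F :=
  Fin.cons 0 fun i => c i.castSucc ^ p

theorem apply_linearCombination_iterate {n : ℕ} {x : A} (hx : f^[n + 1] x = 0)
    (c : Fin (n + 1) → F) :
    f (Fintype.linearCombination F (fun j : Fin (n + 1) => f^[j] x) c) =
      Fintype.linearCombination F (fun j : Fin (n + 1) => f^[j] x) (shift p c) := by
  rw [Fintype.linearCombination_apply, Fintype.linearCombination_apply, map_sum,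
    Fin.sum_univ_castSucc, Fin.sum_univ_succ]
  simp only [map_smulₛₗ, ← Function.iterate_succ_apply' f]
  simp [shift, frobenius_def, hx]

variable [PerfectField F]

/-- The linear functional `x ↦ (μ (f^[m] x))^(1/p^m)` attached to a functional `μ`. -/
noncomputable def rootFunctional (μ : A →ₗ[F] F) (m : ℕ) : A →ₗ[F] F where
  toFun x := (iterateFrobeniusEquiv F p m).symm (μ (f^[m] x))
  map_add' x y := by rw [iterate_map_add, map_add, map_add]
  map_smul' c x := by
    rw [iterate_smul, map_smul, smul_eq_mul, map_mul, ← iterateFrobeniusEquiv_def,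
      RingEquiv.symm_apply_apply, RingHom.id_apply, smul_eq_mul]

theorem rootFunctional_apply (μ : A →ₗ[F] F) (m : ℕ) (x : A) :
    rootFunctional f μ m x = (iterateFrobeniusEquiv F p m).symm (μ (f^[m] x)) := rfl

theorem rootFunctional_eq_zero_iff (μ : A →ₗ[F] F) (m : ℕ) (x : A) :
    rootFunctional f μ m x = 0 ↔ μ (f^[m] x) = 0 := by
  rw [rootFunctional_apply, map_eq_zero_iff _ (RingEquiv.injective _)]

theorem rootFunctional_succ_pow (μ : A →ₗ[F] F) (m : ℕ) (x : A) :
    rootFunctional f μ (m + 1) x ^ p = rootFunctional f μ m (f x) := by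
  apply (iterateFrobeniusEquiv F p m).injective
  rw [rootFunctional_apply, rootFunctional_apply, RingEquiv.apply_symm_apply,
    ← Function.iterate_succ_apply, iterateFrobeniusEquiv_def, ← pow_mul, ← pow_succ',
    ← iterateFrobeniusEquiv_def, RingEquiv.apply_symm_apply]

/-- The range of an iterate of a Frobenius-semilinear map, as a subspace. -/
def rangeIterate (k : ℕ) : Submodule F A where
  carrier := Set.range f^[k]
  add_mem' := by
    rintro _ _ ⟨x, rfl⟩ ⟨y, rfl⟩
    exact ⟨x + y, iterate_map_add f k x y⟩
  zero_mem' := ⟨0, iterate_map_zero f k⟩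
  smul_mem' := by
    rintro c _ ⟨x, rfl⟩
    refine ⟨(iterateFrobeniusEquiv F p k).symm c • x, ?_⟩
    rw [iterate_smul, ← iterateFrobeniusEquiv_def, RingEquiv.apply_symm_apply]

theorem mem_rangeIterate {k : ℕ} {x : A} : x ∈ rangeIterate f k ↔ ∃ y, f^[k] y = x := Iff.rfl

end Iterate

section Lifting

variable {p : ℕ} {F : Type*} [Field F] [Fact p.Prime] [CharP F p] [PerfectField F]
  {B V : Type*} [AddCommGroup B] [Module F B] [AddCommGroup V] [Module F V]
  (g : B →ₛₗ[frobenius F p] B)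

theorem injective_rootFunctional_comp_linearCombination {A : Type*} [AddCommGroup A] [Module F A]
    (f : A →ₛₗ[frobenius F p] A) {n : ℕ} {a : A} (ha : f^[n + 1] a = 0) {μ : A →ₗ[F] F}
    (hμ : μ (f^[n] a) ≠ 0) :
    Function.Injective ((LinearMap.pi fun j : Fin (n + 1) => rootFunctional f μ j) ∘ₗ
      Fintype.linearCombination F fun j : Fin (n + 1) => f^[j] a) := by
  rw [← LinearMap.ker_eq_bot, LinearMap.ker_eq_bot']
  intro c hc
  have key : ∀ i : ℕ, ∀ hi : i < n + 1, c ⟨i, hi⟩ = 0 := by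
    intro i
    induction i using Nat.strong_induction_on with
    | _ i ih =>
      intro hi
      have h := congrFun hc ⟨n - i, by omega⟩
      rw [LinearMap.comp_apply, LinearMap.pi_apply, Pi.zero_apply, rootFunctional_eq_zero_iff,
        Fintype.linearCombination_apply, iterate_sum, Finset.sum_eq_single ⟨i, hi⟩] at h
      · rw [iterate_smul, map_smul, ← Function.iterate_add_apply, smul_eq_mul,
          Nat.sub_add_cancel (Nat.lt_succ_iff.mp hi)] at h
        exact eq_zero_of_pow_eq_zero ((mul_eq_zero.mp h).resolve_right hμ)
      · rintro ⟨j, hj⟩ - hji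
        rw [iterate_smul, ← Function.iterate_add_apply]
        rcases lt_or_gt_of_ne (fun h => hji (Fin.ext h) : j ≠ i) with hlt | hgt
        · rw [ih j hlt hj, zero_pow (pow_ne_zero _ (Fact.out : p.Prime).ne_zero), zero_smul]
        · rw [iterate_eq_zero_of_le f (by simp only; omega) ha, smul_zero]
      · simp
  exact funext fun i => key i i.2

/-- A linear map `τ : A → V` out of a finite-dimensional nilpotent Frobenius module lifts along
`q : B → V` to a morphism of Frobenius modules, provided every element of `ker f^k` can be lifted
to an element of `ker g^k`. -/
theorem exists_equivariant_lift {A : Type*} [AddCommGroup A] [Module F A] [FiniteDimensional F A]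
    (f : A →ₛₗ[frobenius F p] A) (hf : ∃ s, ∀ x, f^[s] x = 0) (q : B →ₗ[F] V)
    (hq : ∀ b, q (g b) = 0) (τ : A →ₗ[F] V) (hτ : ∀ a, τ (f a) = 0)
    (hlift : ∀ k a, f^[k] a = 0 → ∃ b, g^[k] b = 0 ∧ q b = τ a) :
    ∃ h : A →ₗ[F] B, (∀ a, h (f a) = g (h a)) ∧ ∀ a, q (h a) = τ a := by
  induction hd : Module.finrank F A using Nat.strong_induction_on generalizing A with
  | _ d ih =>
  classical
  obtain hs | ⟨n, hs, a, ha⟩ : (∀ x : A, x = 0) ∨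
      ∃ n, (∀ x, f^[n + 1] x = 0) ∧ ∃ a, f^[n] a ≠ 0 := by
    rcases hn : Nat.find hf with _ | n
    · exact Or.inl (by simpa [hn] using Nat.find_spec hf)
    · refine Or.inr ⟨n, by simpa only [hn] using Nat.find_spec hf, ?_⟩
      simpa using Nat.find_min hf (m := n) (by omega)
  · exact ⟨0, fun a => by simp, fun a => by simp [hs a]⟩
  obtain ⟨μ, hμ⟩ : ∃ μ : A →ₗ[F] F, μ (f^[n] a) ≠ 0 := by
    by_contra! h
    exact ha ((Module.forall_dual_apply_eq_zero_iff F _).mp h)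
  set Θ : A →ₗ[F] (Fin (n + 1) → F) := LinearMap.pi fun j => rootFunctional f μ j with hΘ
  set s := Fintype.linearCombination F fun j : Fin (n + 1) => f^[j] a with hs_def
  let E := LinearEquiv.ofInjectiveEndo (Θ ∘ₗ s)
    (injective_rootFunctional_comp_linearCombination f (hs a) hμ)
  have hE : ∀ c, E c = Θ (s c) := fun c => rfl
  let r : A →ₗ[F] (Fin (n + 1) → F) := E.symm.toLinearMap ∘ₗ Θ
  have hrs : ∀ c, r (s c) = c := fun c => by
    change E.symm (Θ (s c)) = c
    rw [← hE, LinearEquiv.symm_apply_apply]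
  have hr0 : ∀ x, x ∈ LinearMap.ker Θ → r x = 0 := fun x hx => by
    change E.symm (Θ x) = 0
    rw [LinearMap.mem_ker.mp hx, map_zero]
  have hΘr : ∀ x, Θ (s (r x)) = Θ x := fun x => by
    rw [← hE]
    exact E.apply_symm_apply _
  have hstable : ∀ x ∈ LinearMap.ker Θ, f x ∈ LinearMap.ker Θ := by
    intro x hx
    have hx' : ∀ j : ℕ, μ (f^[j] x) = 0 := by
      intro j
      by_cases hj : j < n + 1
      · exact (rootFunctional_eq_zero_iff f μ j x).mp (congrFun hx ⟨j, hj⟩)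
      · rw [iterate_eq_zero_of_le f (not_lt.mp hj) (hs x), map_zero]
    refine LinearMap.mem_ker.mpr (funext fun j => ?_)
    rw [hΘ, LinearMap.pi_apply, Pi.zero_apply, rootFunctional_eq_zero_iff,
      ← Function.iterate_succ_apply]
    exact hx' _
  let f' : LinearMap.ker Θ →ₛₗ[frobenius F p] LinearMap.ker Θ :=
    { toFun := fun x => ⟨f x, hstable x x.2⟩
      map_add' := fun x y => Subtype.ext (map_add f _ _)
      map_smul' := fun c x => Subtype.ext (map_smulₛₗ f _ _) }
  have hf' : ∀ k (x : LinearMap.ker Θ), ((f'^[k] x : LinearMap.ker Θ) : A) = f^[k] x := by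
    intro k x
    induction k with
    | zero => rfl
    | succ k ihk =>
      rw [Function.iterate_succ_apply', Function.iterate_succ_apply', ← ihk]
      rfl
  have hlt : Module.finrank F (LinearMap.ker Θ) < d := by
    rw [← hd]
    refine Submodule.finrank_lt fun htop => hμ ?_
    have haΘ : a ∈ LinearMap.ker Θ := htop ▸ Submodule.mem_top
    exact (rootFunctional_eq_zero_iff f μ n a).mp (congrFun haΘ (Fin.last n))
  obtain ⟨h', hh', hqh'⟩ := ih _ hlt f' ⟨n + 1, fun x => Subtype.ext (by rw [hf', hs]; rfl)⟩
    (τ ∘ₗ (LinearMap.ker Θ).subtype) (fun x => hτ x)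
    (fun k x hx => hlift k x (by rw [← hf', hx]; rfl)) rfl
  obtain ⟨b, hb, hqb⟩ := hlift (n + 1) a (hs a)
  let π : A →ₗ[F] LinearMap.ker Θ :=
    LinearMap.codRestrict (LinearMap.ker Θ) (LinearMap.id - s ∘ₗ r) fun x => by
      simp [hΘr]
  have hπ : ∀ x, x = s (r x) + π x := fun x => by simp [π]
  have hrf : ∀ x, r (f x) = shift p (r x) := fun x => by
    conv_lhs => rw [hπ x]
    rw [map_add, apply_linearCombination_iterate f (hs a), map_add, hrs,
      hr0 _ (hstable _ (π x).2), add_zero]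
  have hπf : ∀ x, π (f x) = f' (π x) := fun x => by
    apply Subtype.ext
    have h1 := hπ (f x)
    have h2 := congrArg f (hπ x)
    rw [map_add, apply_linearCombination_iterate f (hs a), ← hrf] at h2
    exact add_left_cancel (h1.symm.trans h2)
  refine ⟨(Fintype.linearCombination F fun j : Fin (n + 1) => g^[j] b) ∘ₗ r + h' ∘ₗ π,
    fun x => ?_, fun x => ?_⟩
  · simp only [LinearMap.add_apply, LinearMap.comp_apply]
    rw [map_add, apply_linearCombination_iterate g hb, hrf, hπf, hh']
  · conv_rhs => rw [hπ x]
    simp only [LinearMap.add_apply, LinearMap.comp_apply, map_add]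
    rw [hqh']
    congr 1
    rw [hs_def, Fintype.linearCombination_apply, Fintype.linearCombination_apply, map_sum, map_sum]
    refine Finset.sum_congr rfl fun j _ => ?_
    rw [map_smul, map_smul]
    congr 1
    rcases j with ⟨_ | j, hj⟩
    · exact hqb
    · simp only [Function.iterate_succ_apply', hq, hτ]

end Lifting

section Envelope

open MvPolynomial

variable {p : ℕ} {F : Type*} [Field F] [Fact p.Prime] [CharP F p]
  {B : Type*} [AddCommGroup B] [Module F B]

variable (F B) in
/-- The index type of a chosen basis of `B`. -/
abbrev BasisIndex := Module.Basis.ofVectorSpaceIndex F B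

variable (F B) in
/-- The embedding of `B` into the polynomial ring on a basis of `B`. -/
noncomputable def linForm : B →ₗ[F] MvPolynomial (BasisIndex F B) F :=
  (Module.Basis.ofVectorSpace F B).constr F X

theorem linForm_basis (i : BasisIndex F B) :
    linForm F B (Module.Basis.ofVectorSpace F B i) = X i :=
  (Module.Basis.ofVectorSpace F B).constr_basis F X i

theorem linForm_eq_sum (x : B) : linForm F B x =
    ((Module.Basis.ofVectorSpace F B).repr x).sum fun i c => monomial (Finsupp.single i 1) c := by
  rw [linForm, Module.Basis.constr_apply]
  simp only [X, smul_monomial, smul_eq_mul, mul_one]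

theorem aeval_linForm {T : Type*} [CommRing T] [Algebra F T] (θ : B →ₗ[F] T) (x : B) :
    aeval (fun i => θ (Module.Basis.ofVectorSpace F B i)) (linForm F B x) = θ x := by
  have h : (aeval fun i => θ (Module.Basis.ofVectorSpace F B i)).toLinearMap ∘ₗ linForm F B = θ :=
    (Module.Basis.ofVectorSpace F B).ext fun i => by
      rw [LinearMap.comp_apply, linForm_basis, AlgHom.toLinearMap_apply, aeval_X]
  exact LinearMap.congr_fun h x

variable (g : B →ₛₗ[frobenius F p] B)

/-- The polynomial `x_i^p - g(x_i)`. -/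
noncomputable def relator (i : BasisIndex F B) : MvPolynomial (BasisIndex F B) F :=
  X i ^ p - linForm F B (g (Module.Basis.ofVectorSpace F B i))

/-- The universal commutative algebra generated by `B` subject to `x ^ p = g x`. -/
def Envelope := MvPolynomial (BasisIndex F B) F ⧸ Ideal.span (Set.range (relator g))

noncomputable instance : CommRing (Envelope g) :=
  inferInstanceAs (CommRing (MvPolynomial (BasisIndex F B) F ⧸ Ideal.span (Set.range (relator g))))

noncomputable instance : Algebra F (Envelope g) :=
  inferInstanceAs
    (Algebra F (MvPolynomial (BasisIndex F B) F ⧸ Ideal.span (Set.range (relator g))))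

/-- The quotient map onto `Envelope g`. -/
noncomputable def toEnvelope : MvPolynomial (BasisIndex F B) F →ₐ[F] Envelope g :=
  Ideal.Quotient.mkₐ F (Ideal.span (Set.range (relator g)))

theorem toEnvelope_surjective : Function.Surjective (toEnvelope g) :=
  Ideal.Quotient.mk_surjective

theorem toEnvelope_eq_zero_iff {r : MvPolynomial (BasisIndex F B) F} :
    toEnvelope g r = 0 ↔ r ∈ Ideal.span (Set.range (relator g)) :=
  Ideal.Quotient.eq_zero_iff_mem

/-- The canonical map `B → Envelope g`. -/
noncomputable def emb : B →ₗ[F] Envelope g := (toEnvelope g).toLinearMap ∘ₗ linForm F B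

theorem emb_apply (x : B) : emb g x = toEnvelope g (linForm F B x) := rfl

/-- The universal property of `Envelope g`. -/
noncomputable def lift {T : Type*} [CommRing T] [Algebra F T] (θ : B →ₗ[F] T)
    (hθ : ∀ x, θ (g x) = θ x ^ p) : Envelope g →ₐ[F] T :=
  Ideal.Quotient.liftₐ _ (aeval fun i => θ (Module.Basis.ofVectorSpace F B i)) fun a ha => by
    rw [← RingHom.mem_ker]
    refine (Ideal.span_le (I := RingHom.ker _)).mpr ?_ ha
    rintro _ ⟨i, rfl⟩
    change aeval _ (X i ^ p - linForm F B (g _)) = 0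
    rw [map_sub, aeval_linForm, map_pow, aeval_X, hθ, sub_self]

@[simp]
theorem lift_emb {T : Type*} [CommRing T] [Algebra F T] (θ : B →ₗ[F] T)
    (hθ : ∀ x, θ (g x) = θ x ^ p) (x : B) : lift g θ hθ (emb g x) = θ x :=
  aeval_linForm θ x

/-- The augmentation of `Envelope g`. -/
noncomputable def counit : Envelope g →ₐ[F] F :=
  lift g 0 fun x => by simp [(Fact.out : p.Prime).ne_zero]

@[simp]
theorem counit_emb (x : B) : counit g (emb g x) = 0 := lift_emb g _ _ x

instance : Nontrivial (Envelope g) := (counit g).toRingHom.domain_nontrivial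

instance : CharP (Envelope g) p :=
  charP_of_injective_algebraMap (algebraMap F (Envelope g)).injective p

theorem emb_map (x : B) : emb g (g x) = emb g x ^ p := by
  let φ : B →ₛₗ[frobenius F p] Envelope g :=
    { toFun := fun x => emb g x ^ p
      map_add' := fun x y => by rw [map_add, add_pow_char]
      map_smul' := fun c x => by rw [map_smul, smul_pow, frobenius_def] }
  have h : (emb g).comp g = φ := (Module.Basis.ofVectorSpace F B).ext fun i => by
    change toEnvelope g (linForm F B (g _)) = (toEnvelope g (linForm F B _)) ^ p
    rw [linForm_basis, ← map_pow, eq_comm, ← sub_eq_zero, ← map_sub, toEnvelope_eq_zero_iff]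
    exact Ideal.subset_span ⟨i, rfl⟩
  exact LinearMap.congr_fun h x

theorem emb_iterate (k : ℕ) (x : B) : emb g (g^[k] x) = emb g x ^ p ^ k := by
  induction k with
  | zero => simp
  | succ k ih => rw [Function.iterate_succ_apply', emb_map, ih, ← pow_mul, pow_succ]

theorem envelope_induction {P : Envelope g → Prop} (hC : ∀ c : F, P (algebraMap F _ c))
    (hadd : ∀ a b, P a → P b → P (a + b)) (hmul : ∀ a x, P a → P (a * emb g x))
    (r : Envelope g) : P r := by
  obtain ⟨r, rfl⟩ := toEnvelope_surjective g r
  induction r using MvPolynomial.induction_on with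
  | C a => rw [← algebraMap_eq, AlgHom.commutes]; exact hC a
  | add a b ha hb => rw [map_add]; exact hadd _ _ ha hb
  | mul_X a i ha => rw [map_mul, ← linForm_basis, ← emb_apply]; exact hmul _ _ ha

theorem envelope_hom_ext {T : Type*} [CommRing T] [Algebra F T] {φ ψ : Envelope g →ₐ[F] T}
    (h : ∀ x, φ (emb g x) = ψ (emb g x)) : φ = ψ := by
  refine AlgHom.ext fun r => ?_
  induction r using envelope_induction with
  | hC c => simp
  | hadd a b ha hb => rw [map_add, map_add, ha, hb]
  | hmul a x ha => rw [map_mul, map_mul, ha, h]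

/-- The augmentation ideal of `Envelope g`. -/
noncomputable def augIdeal : Ideal (Envelope g) := Ideal.span (Set.range (emb g))

theorem emb_mem_augIdeal (x : B) : emb g x ∈ augIdeal g := Ideal.subset_span ⟨x, rfl⟩

theorem exists_eq_counit_add_emb_add (r : Envelope g) :
    ∃ x, ∃ w ∈ augIdeal g ^ 2, r = algebraMap F _ (counit g r) + emb g x + w := by
  induction r using envelope_induction with
  | hC c => exact ⟨0, 0, zero_mem _, by simp⟩
  | hadd a b ha hb =>
    obtain ⟨x, w, hw, hx⟩ := ha
    obtain ⟨y, v, hv, hy⟩ := hb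
    refine ⟨x + y, w + v, add_mem hw hv, ?_⟩
    conv_lhs => rw [hx, hy]
    simp only [map_add]
    ring
  | hmul a y ha =>
    obtain ⟨x, w, hw, hx⟩ := ha
    refine ⟨counit g a • y, (emb g x + w) * emb g y, ?_, ?_⟩
    · rw [sq]
      exact Ideal.mul_mem_mul (add_mem (emb_mem_augIdeal g x) (Ideal.pow_le_self two_ne_zero hw))
        (emb_mem_augIdeal g y)
    · conv_lhs => rw [hx]
      simp only [map_mul, counit_emb, mul_zero, map_zero, map_smul]
      rw [show counit g a • emb g y = algebraMap F _ (counit g a) * emb g y from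
        Algebra.smul_def _ _]
      ring

theorem pow_eq_zero_of_counit_eq_zero {s : ℕ} (hs : ∀ x, g^[s] x = 0) {r : Envelope g}
    (hr : counit g r = 0) : r ^ p ^ s = 0 := by
  have h : ∀ r : Envelope g, r ^ p ^ s = algebraMap F _ (counit g r) ^ p ^ s := by
    intro r
    induction r using envelope_induction with
    | hC c => simp
    | hadd a b ha hb => rw [add_pow_char_pow, ha, hb, map_add, map_add, add_pow_char_pow]
    | hmul a x ha =>
      rw [mul_pow, ← emb_iterate, hs, map_mul, counit_emb]
      simp [(Fact.out : p.Prime).ne_zero]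
  rw [h, hr, map_zero, zero_pow (pow_ne_zero _ (Fact.out : p.Prime).ne_zero)]

end Envelope

section Embedding

open MvPolynomial

variable {σ F : Type*} [Field F]

variable (σ F) in
/-- The polynomials all of whose monomials have degree less than `d`. -/
noncomputable abbrev degreeLT (d : ℕ) : Submodule F (MvPolynomial σ F) :=
  restrictSupport F {n | n.degree < d}

theorem mem_degreeLT {d : ℕ} {r : MvPolynomial σ F} :
    r ∈ degreeLT σ F d ↔ ∀ n, coeff n r ≠ 0 → n.degree < d := by
  rw [mem_restrictSupport_iff]
  exact ⟨fun h n hn => h (mem_support_iff.mpr hn), fun h n hn => h n (mem_support_iff.mp hn)⟩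

theorem degreeLT_mono {d e : ℕ} (h : d ≤ e) : degreeLT σ F d ≤ degreeLT σ F e :=
  restrictSupport_mono F fun _ hn => lt_of_lt_of_le hn h

theorem monomial_mem_degreeLT {d : ℕ} {n : σ →₀ ℕ} (hn : n.degree < d) (c : F) :
    monomial n c ∈ degreeLT σ F d :=
  (monomial_mem_restrictSupport F).mpr (Or.inl hn)

theorem mul_mem_degreeLT {d e : ℕ} {q r : MvPolynomial σ F} (hq : q ∈ degreeLT σ F (d + 1))
    (hr : r ∈ degreeLT σ F e) : q * r ∈ degreeLT σ F (d + e) := by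
  classical
  refine mem_degreeLT.mpr fun n hn => ?_
  rw [coeff_mul] at hn
  obtain ⟨⟨a, b⟩, hab, h⟩ := Finset.exists_ne_zero_of_sum_ne_zero hn
  have ha := mem_degreeLT.mp hq a (left_ne_zero_of_mul h)
  have hb := mem_degreeLT.mp hr b (right_ne_zero_of_mul h)
  rw [← Finset.HasAntidiagonal.mem_antidiagonal.mp hab, map_add]
  dsimp only
  omega

/-- The leading form of `∏ (x_i^p - ℓ_i)^(m_i) * x^a`, where the `ℓ_i` have degree at most one, is
`x^(p m + a)`. -/
theorem aeval_monomial_mul_sub_mem_degreeLT {p : ℕ} (hp : 2 ≤ p) {ℓ : σ → MvPolynomial σ F}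
    (hℓ : ∀ i, ℓ i ∈ degreeLT σ F 2) (m a : σ →₀ ℕ) :
    aeval (fun i => X i ^ p - ℓ i) (monomial m (1 : F)) * monomial a 1 - monomial (p • m + a) 1 ∈
      degreeLT σ F (p • m + a).degree := by
  have bound : ∀ {m}, (∀ a, aeval (fun i => X i ^ p - ℓ i) (monomial m (1 : F)) * monomial a 1 -
      monomial (p • m + a) 1 ∈ degreeLT σ F (p • m + a).degree) →
      aeval (fun i => X i ^ p - ℓ i) (monomial m (1 : F)) ∈
        degreeLT σ F ((p • m).degree + 1) := by
    intro m hm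
    have h := add_mem (degreeLT_mono (Nat.le_succ _) (hm 0))
      (monomial_mem_degreeLT (Nat.lt_succ_self _) 1)
    rwa [sub_add_cancel, add_zero, show monomial (0 : σ →₀ ℕ) (1 : F) = 1 from rfl, mul_one] at h
  have hadd : ∀ m m' : σ →₀ ℕ,
      (∀ a, aeval (fun i => X i ^ p - ℓ i) (monomial m (1 : F)) * monomial a 1 -
        monomial (p • m + a) 1 ∈ degreeLT σ F (p • m + a).degree) →
      (∀ a, aeval (fun i => X i ^ p - ℓ i) (monomial m' (1 : F)) * monomial a 1 -
        monomial (p • m' + a) 1 ∈ degreeLT σ F (p • m' + a).degree) →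
      ∀ a, aeval (fun i => X i ^ p - ℓ i) (monomial (m + m') (1 : F)) * monomial a 1 -
        monomial (p • (m + m') + a) 1 ∈ degreeLT σ F (p • (m + m') + a).degree := by
    intro m m' hm hm' a
    have e : monomial (m + m') (1 : F) = monomial m 1 * monomial m' 1 := by simp
    have e' : p • (m + m') + a = p • m + (p • m' + a) := by rw [smul_add, add_assoc]
    have h := add_mem (hm (p • m' + a)) (by
      rw [map_add]
      exact mul_mem_degreeLT (bound hm) (hm' a))
    rw [e', e, map_mul]
    convert h using 1
    ring
  have hone : ∀ i a, aeval (fun i => X i ^ p - ℓ i) (monomial (Finsupp.single i 1) (1 : F)) *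
      monomial a 1 - monomial (p • Finsupp.single i 1 + a) 1 ∈
        degreeLT σ F (p • Finsupp.single i 1 + a).degree := by
    intro i a
    have h := neg_mem (degreeLT_mono (by
        rw [map_add, Finsupp.smul_single, Finsupp.degree_single, smul_eq_mul]
        omega)
      (mul_mem_degreeLT (d := 1) (hℓ i)
        (monomial_mem_degreeLT (Nat.lt_succ_self a.degree) (1 : F))) :
      ℓ i * monomial a 1 ∈ degreeLT σ F (p • Finsupp.single i 1 + a).degree)
    convert h using 1
    have e : monomial (p • Finsupp.single i 1 + a) (1 : F) = X i ^ p * monomial a 1 := by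
      rw [X_pow_eq_monomial, monomial_mul, one_mul, Finsupp.smul_single, smul_eq_mul, mul_one]
    rw [e, show monomial (Finsupp.single i 1) (1 : F) = X i from rfl, aeval_X]
    ring
  have hzero : ∀ a, aeval (fun i => X i ^ p - ℓ i) (monomial 0 (1 : F)) * monomial a 1 -
      monomial (p • 0 + a) 1 ∈ degreeLT σ F (p • 0 + a).degree := by
    intro a
    rw [show monomial (0 : σ →₀ ℕ) (1 : F) = 1 from rfl, map_one, one_mul, smul_zero, zero_add,
      sub_self]
    exact zero_mem _
  induction m using Finsupp.induction_linear generalizing a with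
  | zero => exact hzero a
  | add m m' hm hm' => exact hadd m m' hm hm' a
  | single i k =>
    induction k generalizing a with
    | zero => rw [Finsupp.single_zero]; exact hzero a
    | succ k ih => rw [Finsupp.single_add]; exact hadd _ _ ih (hone i) a

/-- A polynomial of degree less than `p` in each variable is zero if it lies in the ideal generated
by polynomials of the form `x_i^p - ℓ_i` with `ℓ_i` of degree at most one. -/
theorem eq_zero_of_mem_span_of_forall_lt {p : ℕ} (hp : 2 ≤ p) {ℓ : σ → MvPolynomial σ F}
    (hℓ : ∀ i, ℓ i ∈ degreeLT σ F 2) {r : MvPolynomial σ F}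
    (hr : r ∈ Ideal.span (Set.range fun i => X i ^ p - ℓ i))
    (hrp : ∀ n, coeff n r ≠ 0 → ∀ i, n i < p) : r = 0 := by
  classical
  let quo : (σ →₀ ℕ) → (σ →₀ ℕ) := fun n => n.mapRange (· / p) (Nat.zero_div p)
  let rem : (σ →₀ ℕ) → (σ →₀ ℕ) := fun n => n.mapRange (· % p) (Nat.zero_mod p)
  have hqr : ∀ n, p • quo n + rem n = n := fun n => by
    ext i
    simpa [quo, rem] using Nat.div_add_mod (n i) p
  let T : MvPolynomial σ F →ₗ[F] MvPolynomial σ F := (basisMonomials σ F).constr F fun n =>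
    aeval (fun i => X i ^ p - ℓ i) (monomial (quo n) (1 : F)) * monomial (rem n) 1
  have hT : ∀ n, T (monomial n 1) =
      aeval (fun i => X i ^ p - ℓ i) (monomial (quo n) (1 : F)) * monomial (rem n) 1 := fun n => by
    have h := (basisMonomials σ F).constr_basis F (fun n =>
      aeval (fun i => X i ^ p - ℓ i) (monomial (quo n) (1 : F)) * monomial (rem n) 1) n
    rwa [coe_basisMonomials] at h
  have hmon : ∀ (n : σ →₀ ℕ) (c : F), monomial n c = c • monomial n 1 := fun n c => by
    rw [smul_monomial, smul_eq_mul, mul_one]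
  have hTsub : ∀ n, T (monomial n 1) - monomial n 1 ∈ degreeLT σ F n.degree := fun n => by
    have h := aeval_monomial_mul_sub_mem_degreeLT hp hℓ (quo n) (rem n)
    rwa [← hT, hqr] at h
  have hinj : ∀ q, T q = 0 → q = 0 := by
    intro q hq
    by_contra hne
    obtain ⟨n, hn, hmax⟩ := q.support.exists_max_image Finsupp.degree (support_nonempty.mpr hne)
    have h : T q - q ∈ degreeLT σ F n.degree := by
      have e : T q - q = ∑ m ∈ q.support, coeff m q • (T (monomial m 1) - monomial m 1) := by
        simp only [smul_sub, Finset.sum_sub_distrib, ← map_smul T, ← map_sum T, ← hmon,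
          support_sum_monomial_coeff]
      rw [e]
      exact sum_mem fun m hm => Submodule.smul_mem _ _ (degreeLT_mono (hmax m hm) (hTsub m))
    rw [hq, zero_sub, neg_mem_iff] at h
    exact lt_irrefl _ (mem_degreeLT.mp h n (mem_support_iff.mp hn))
  have hle : ∀ d, degreeLT σ F d ≤ LinearMap.range T := by
    intro d
    induction d with
    | zero =>
      rw [degreeLT, restrictSupport_eq_span, Submodule.span_le]
      rintro _ ⟨n, hn, rfl⟩
      exact absurd hn (Nat.not_lt_zero _)
    | succ d ih =>
      rw [degreeLT, restrictSupport_eq_span, Submodule.span_le]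
      rintro _ ⟨n, hn, rfl⟩
      have h := sub_mem (LinearMap.mem_range_self T (monomial n 1))
        (ih (degreeLT_mono (Nat.lt_succ_iff.mp hn) (hTsub n)))
      rwa [sub_sub_cancel] at h
  have hsurj : ∀ q, ∃ q', T q' = q := by
    intro q
    rw [← support_sum_monomial_coeff q]
    exact LinearMap.mem_range.mp (sum_mem fun n _ =>
      hle _ (monomial_mem_degreeLT (Nat.lt_succ_self n.degree) _))
  have hmul : ∀ q i, T q * (X i ^ p - ℓ i) ∈
      (restrictSupport F {n | quo n ≠ 0}).map T := by
    intro q i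
    rw [← support_sum_monomial_coeff q, map_sum, Finset.sum_mul]
    refine sum_mem fun n _ => ?_
    rw [hmon, map_smul, smul_mul_assoc]
    refine Submodule.smul_mem _ _ ⟨monomial (n + Finsupp.single i p) 1, ?_, ?_⟩
    · refine (monomial_mem_restrictSupport F).mpr (Or.inl fun h => ?_)
      have := DFunLike.congr_fun h i
      simp [quo] at this
      omega
    · have hpos : 0 < p := by omega
      have h1 : quo (n + Finsupp.single i p) = quo n + Finsupp.single i 1 := by
        ext j
        rcases eq_or_ne i j with rfl | hij
        · simp [quo, Nat.add_div_right _ hpos]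
        · simp [quo, Finsupp.single_eq_of_ne' hij]
      have h2 : rem (n + Finsupp.single i p) = rem n := by
        ext j
        rcases eq_or_ne i j with rfl | hij
        · simp [rem]
        · simp [rem, Finsupp.single_eq_of_ne' hij]
      have h3 : monomial (quo n + Finsupp.single i 1) (1 : F) = monomial (quo n) 1 * X i := by
        rw [X, monomial_mul, one_mul]
      rw [hT, hT, h1, h2, h3, map_mul, aeval_X]
      ring
  obtain ⟨q, hq, hqr'⟩ : r ∈ (restrictSupport F {n | quo n ≠ 0}).map T := by
    obtain ⟨c, rfl⟩ := Finsupp.mem_span_range_iff_exists_finsupp.mp hr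
    refine sum_mem fun i _ => ?_
    obtain ⟨q, hq⟩ := hsurj (c i)
    simp only [smul_eq_mul, ← hq]
    exact hmul q i
  have hTr : T r = r := by
    rw [← support_sum_monomial_coeff r, map_sum]
    refine Finset.sum_congr rfl fun n hn => ?_
    have h0 : quo n = 0 := by
      ext i
      exact Nat.div_eq_of_lt (hrp n (mem_support_iff.mp hn) i)
    have h := hqr n
    rw [h0, smul_zero, zero_add] at h
    rw [hmon, map_smul, hT, h0, h, show monomial (0 : σ →₀ ℕ) (1 : F) = 1 from rfl, map_one, one_mul]
  obtain rfl : q = r := sub_eq_zero.mp (hinj _ (by rw [map_sub, hqr', hTr, sub_self]))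
  by_contra hne
  obtain ⟨n, hn⟩ := support_nonempty.mpr hne
  refine hq hn ?_
  ext i
  exact Nat.div_eq_of_lt (hrp n (mem_support_iff.mp hn) i)

variable {p : ℕ} [Fact p.Prime] [CharP F p] {B : Type*} [AddCommGroup B] [Module F B]
  (g : B →ₛₗ[frobenius F p] B)

theorem coeff_linForm_single (x : B) (i : BasisIndex F B) :
    coeff (Finsupp.single i 1) (linForm F B x) = (Module.Basis.ofVectorSpace F B).repr x i := by
  classical
  rw [linForm_eq_sum, Finsupp.sum, coeff_sum]
  simp [coeff_monomial, Finsupp.single_left_inj, eq_comm]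

theorem exists_eq_single_of_coeff_linForm_ne_zero {x : B} {n : BasisIndex F B →₀ ℕ}
    (hn : coeff n (linForm F B x) ≠ 0) : ∃ i, n = Finsupp.single i 1 := by
  classical
  rw [linForm_eq_sum, Finsupp.sum, coeff_sum] at hn
  obtain ⟨i, _, hi⟩ := Finset.exists_ne_zero_of_sum_ne_zero hn
  rw [coeff_monomial] at hi
  exact ⟨i, by by_contra h; simp [Ne.symm h] at hi⟩

theorem emb_injective : Function.Injective (emb g) := by
  classical
  have hp : 2 ≤ p := (Fact.out : p.Prime).two_le
  rw [← LinearMap.ker_eq_bot, LinearMap.ker_eq_bot']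
  intro x hx
  have h0 : linForm F B x = 0 := by
    refine eq_zero_of_mem_span_of_forall_lt hp
      (ℓ := fun i => linForm F B (g (Module.Basis.ofVectorSpace F B i))) (fun i => ?_)
      ((toEnvelope_eq_zero_iff g).mp hx) fun n hn i => ?_
    · refine mem_degreeLT.mpr fun n hn => ?_
      obtain ⟨j, rfl⟩ := exists_eq_single_of_coeff_linForm_ne_zero hn
      rw [Finsupp.degree_single]
      exact one_lt_two
    · obtain ⟨j, rfl⟩ := exists_eq_single_of_coeff_linForm_ne_zero hn
      rw [Finsupp.single_apply]
      split_ifs <;> omega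
  refine (Module.Basis.ofVectorSpace F B).repr.map_eq_zero_iff.mp (Finsupp.ext fun i => ?_)
  rw [← coeff_linForm_single, h0, coeff_zero, Finsupp.zero_apply]

end Embedding

section Augmentation

variable {p : ℕ} {F : Type*} [Field F] [Fact p.Prime] [CharP F p]
  {A B : Type*} [AddCommGroup A] [Module F A] [AddCommGroup B] [Module F B]
  (f : A →ₛₗ[frobenius F p] A) {g : B →ₛₗ[frobenius F p] B}

theorem algHom_eq_counit (hf : ∃ s, ∀ x, f^[s] x = 0) (χ : Envelope f →ₐ[F] F) :
    χ = counit f := by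
  obtain ⟨s, hs⟩ := hf
  refine envelope_hom_ext f fun x => ?_
  have h : χ (emb f x) ^ p ^ s = 0 := by rw [← map_pow, ← emb_iterate, hs, map_zero, map_zero]
  rw [eq_zero_of_pow_eq_zero h, counit_emb]

variable {f}

theorem iterate_eq_zero_of_algEquiv {s : ℕ} (hs : ∀ x, f^[s] x = 0)
    (φ : Envelope f ≃ₐ[F] Envelope g) (x : B) : g^[s] x = 0 := by
  have hc : counit f (φ.symm (emb g x)) = 0 := by
    have := algHom_eq_counit f ⟨s, hs⟩ ((counit g).comp φ.toAlgHom)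
    rw [← this]
    simp
  refine emb_injective g ?_
  rw [emb_iterate, map_zero]
  refine φ.symm.injective ?_
  rw [map_pow, pow_eq_zero_of_counit_eq_zero f hs hc, map_zero]

end Augmentation

section Comparison

variable {p : ℕ} {F : Type*} [Field F] [Fact p.Prime] [CharP F p] [PerfectField F]
  {A B : Type*} [AddCommGroup A] [Module F A] [AddCommGroup B] [Module F B]
  {f : A →ₛₗ[frobenius F p] A} (g : B →ₛₗ[frobenius F p] B)

/-- The additive polynomial `∑ (μ (g^[m] x))^(1/p^m) X^(p^(k-m))`. -/
noncomputable def additivePolynomial (μ : B →ₗ[F] F) (k : ℕ) : B →ₗ[F] Polynomial F :=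
  ∑ m ∈ Finset.range (k + 1),
    (rootFunctional g μ m).smulRight ((Polynomial.X : Polynomial F) ^ p ^ (k - m))

theorem additivePolynomial_apply (μ : B →ₗ[F] F) (k : ℕ) (x : B) :
    additivePolynomial g μ k x = ∑ m ∈ Finset.range (k + 1),
      rootFunctional g μ m x • (Polynomial.X : Polynomial F) ^ p ^ (k - m) := by
  simp [additivePolynomial, LinearMap.sum_apply]

theorem X_dvd_additivePolynomial (μ : B →ₗ[F] F) (k : ℕ) (x : B) :
    Polynomial.X ∣ additivePolynomial g μ k x := by
  rw [additivePolynomial_apply]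
  exact Finset.dvd_sum fun m _ => dvd_smul_of_dvd _
    (dvd_pow_self _ (pow_ne_zero _ (Fact.out : p.Prime).ne_zero))

theorem additivePolynomial_pow {μ : B →ₗ[F] F} {k : ℕ} (hμ : ∀ x, μ (g^[k + 1] x) = 0) (x : B) :
    additivePolynomial g μ k x ^ p = additivePolynomial g μ k (g x) +
      rootFunctional g μ 0 x ^ p • (Polynomial.X : Polynomial F) ^ p ^ (k + 1) := by
  have hlast : rootFunctional g μ k (g x) = 0 := by
    rw [rootFunctional_eq_zero_iff, ← Function.iterate_succ_apply, hμ]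
  rw [additivePolynomial_apply, additivePolynomial_apply, sum_pow_char, Finset.sum_range_succ',
    Finset.sum_range_succ _ k, hlast, zero_smul, add_zero]
  simp only [smul_pow, ← pow_mul, ← pow_succ, Nat.sub_zero, rootFunctional_succ_pow]
  congr 1
  refine Finset.sum_congr rfl fun m hm => ?_
  rw [show k - (m + 1) + 1 = k - m by have := Finset.mem_range.mp hm; omega]

theorem additivePolynomial_iterate {μ : B →ₗ[F] F} {k : ℕ} (hμ : ∀ x, μ (g^[k + 1] x) = 0)
    (x : B) : additivePolynomial g μ k (g^[k] x) = μ (g^[k] x) • Polynomial.X ^ p ^ k := by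
  rw [additivePolynomial_apply, Finset.sum_eq_single 0]
  · simp [rootFunctional_apply]
  · intro m _ hm
    rw [(rootFunctional_eq_zero_iff g μ m _).mpr, zero_smul]
    obtain ⟨m, rfl⟩ := Nat.exists_eq_succ_of_ne_zero hm
    rw [← Function.iterate_add_apply, show m.succ + k = k + 1 + m by omega,
      Function.iterate_add_apply, hμ]
  · simp

/-- If the `p^k`-th power of an element of the augmentation ideal with linear part `b` vanishes,
then `g^[k] b` lies in the range of `g^[k + 1]`. -/
theorem exists_iterate_succ_eq {k : ℕ} {b : B} {w : Envelope g} (hw : w ∈ augIdeal g ^ 2)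
    (h : (emb g b + w) ^ p ^ k = 0) : ∃ b', g^[k + 1] b' = g^[k] b := by
  rw [← mem_rangeIterate]
  by_contra hb
  obtain ⟨μ, hμb, hμ⟩ := Submodule.exists_le_ker_of_notMem hb
  have hμ' : ∀ x, μ (g^[k + 1] x) = 0 := fun x => hμ ⟨x, rfl⟩
  let I : Ideal (Polynomial F) := Ideal.span {Polynomial.X ^ (2 * p ^ k)}
  have hI : ∀ r : Polynomial F, Ideal.Quotient.mkₐ F I r = 0 ↔ Polynomial.X ^ (2 * p ^ k) ∣ r :=
    fun r => by
      rw [Ideal.Quotient.mkₐ_eq_mk, Ideal.Quotient.eq_zero_iff_mem, Ideal.mem_span_singleton]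
  let Θ : Envelope g →ₐ[F] Polynomial F ⧸ I :=
    lift g ((Ideal.Quotient.mkₐ F I).toLinearMap ∘ₗ additivePolynomial g μ k) fun x => by
      rw [LinearMap.comp_apply, LinearMap.comp_apply, AlgHom.toLinearMap_apply,
        AlgHom.toLinearMap_apply, ← map_pow, additivePolynomial_pow g hμ', map_add,
        left_eq_add, hI]
      refine dvd_smul_of_dvd _ (pow_dvd_pow _ ?_)
      rw [pow_succ']
      exact Nat.mul_le_mul_right _ (Fact.out : p.Prime).two_le
  have hΘ : ∀ x, Θ (emb g x) = Ideal.Quotient.mkₐ F I (additivePolynomial g μ k x) :=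
    fun x => lift_emb g _ _ x
  let J : Ideal (Polynomial F ⧸ I) := Ideal.span {Ideal.Quotient.mkₐ F I Polynomial.X}
  have hJ : augIdeal g ≤ J.comap Θ := by
    refine Ideal.span_le.mpr ?_
    rintro _ ⟨x, rfl⟩
    refine Ideal.mem_span_singleton.mpr ?_
    rw [hΘ]
    exact map_dvd _ (X_dvd_additivePolynomial g μ k x)
  have hw0 : Θ w ^ p ^ k = 0 := by
    have h2 : Θ w ∈ J ^ 2 := Ideal.le_comap_pow Θ 2 (Ideal.pow_right_mono hJ 2 hw)
    rw [Ideal.span_singleton_pow, Ideal.mem_span_singleton] at h2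
    obtain ⟨c, hc⟩ := h2
    rw [hc, mul_pow, ← pow_mul, ← map_pow, (hI _).mpr dvd_rfl, zero_mul]
  have key := congrArg Θ h
  rw [add_pow_char_pow, map_add, map_pow Θ w, hw0, add_zero, ← emb_iterate, hΘ,
    additivePolynomial_iterate g hμ', map_zero, hI, Polynomial.X_pow_dvd_iff] at key
  have hpk : 0 < p ^ k := pow_pos (Fact.out : p.Prime).pos k
  have := key (p ^ k) (by omega)
  simp only [Polynomial.coeff_smul, Polynomial.coeff_X_pow_self, smul_eq_mul, mul_one] at this
  exact hμb this

variable {g}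

theorem exists_surjective_equivariant [FiniteDimensional F A] (hf : ∃ s, ∀ x, f^[s] x = 0)
    (φ : Envelope f ≃ₐ[F] Envelope g) :
    ∃ h : A →ₗ[F] B, (∀ a, h (f a) = g (h a)) ∧ Function.Surjective h := by
  have hcounit : ∀ r, counit g (φ r) = counit f r :=
    AlgHom.congr_fun (algHom_eq_counit f hf ((counit g).comp φ.toAlgHom))
  have hdecomp : ∀ a, ∃ b, ∃ w ∈ augIdeal g ^ 2, φ (emb f a) = emb g b + w := fun a => by
    obtain ⟨b, w, hw, h⟩ := exists_eq_counit_add_emb_add g (φ (emb f a))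
    rw [hcounit, counit_emb, map_zero, zero_add] at h
    exact ⟨b, w, hw, h⟩
  have hφ : augIdeal f ≤ (augIdeal g).comap φ := by
    refine Ideal.span_le.mpr ?_
    rintro _ ⟨a, rfl⟩
    obtain ⟨b, w, hw, h⟩ := hdecomp a
    change φ (emb f a) ∈ augIdeal g
    rw [h]
    exact add_mem (emb_mem_augIdeal g b) (Ideal.pow_le_self two_ne_zero hw)
  have hφ2 : ∀ w ∈ augIdeal f ^ 2, φ w ∈ augIdeal g ^ 2 := fun w hw =>
    Ideal.le_comap_pow φ 2 (Ideal.pow_right_mono hφ 2 hw)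
  have hpow : ∀ r ∈ augIdeal g, r ^ p ∈ augIdeal g ^ 2 := fun r hr =>
    Ideal.pow_le_pow_right (Fact.out : p.Prime).two_le (Ideal.pow_mem_pow hr p)
  let N : Submodule F (Envelope g) := (augIdeal g ^ 2).restrictScalars F
  have hN : ∀ r, N.mkQ r = 0 ↔ r ∈ augIdeal g ^ 2 := fun r => by
    rw [Submodule.mkQ_apply, Submodule.Quotient.mk_eq_zero, Submodule.restrictScalars_mem]
  obtain ⟨h, hh, hτ⟩ := exists_equivariant_lift g f hf (N.mkQ ∘ₗ emb g)
    (fun b => by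
      rw [LinearMap.comp_apply, hN, emb_map]
      exact hpow _ (emb_mem_augIdeal g b))
    (N.mkQ ∘ₗ φ.toLinearMap ∘ₗ emb f)
    (fun a => by
      rw [LinearMap.comp_apply, LinearMap.comp_apply, AlgEquiv.toLinearMap_apply, hN, emb_map,
        map_pow]
      exact hpow _ (hφ (emb_mem_augIdeal f a)))
    (fun k a ha => by
      obtain ⟨b, w, hw, h⟩ := hdecomp a
      obtain ⟨b', hb'⟩ := exists_iterate_succ_eq g hw (k := k) (b := b) (by
        rw [← h, ← map_pow, ← emb_iterate, ha, map_zero, map_zero])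
      refine ⟨b - g b', ?_, ?_⟩
      · rw [iterate_map_sub, ← Function.iterate_succ_apply, hb', sub_self]
      · rw [← sub_eq_zero, LinearMap.comp_apply, LinearMap.comp_apply, LinearMap.comp_apply,
          AlgEquiv.toLinearMap_apply, ← map_sub, hN, h, map_sub, emb_map]
        have := neg_mem (add_mem (hpow _ (emb_mem_augIdeal g b')) hw)
        convert this using 1
        ring)
  refine ⟨h, hh, ?_⟩
  have hmod : ∀ b, ∃ a b', b = h a + g b' := by
    intro b
    obtain ⟨a, w, hw, haw⟩ := exists_eq_counit_add_emb_add f (φ.symm (emb g b))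
    rw [← hcounit, AlgEquiv.apply_symm_apply, counit_emb, map_zero, zero_add] at haw
    have hb : emb g b = φ (emb f a) + φ w := by
      rw [← map_add, ← haw, AlgEquiv.apply_symm_apply]
    have hmem : emb g (b - h a) ∈ augIdeal g ^ 2 := by
      have h1 := hτ a
      rw [← sub_eq_zero, LinearMap.comp_apply, LinearMap.comp_apply, LinearMap.comp_apply,
        AlgEquiv.toLinearMap_apply, ← map_sub, hN] at h1
      have h2 := sub_mem (hφ2 w hw) h1
      rw [map_sub, hb]
      convert h2 using 1
      ring
    obtain ⟨b', hb'⟩ := exists_iterate_succ_eq g (neg_mem hmem) (k := 0) (b := b - h a) (by simp)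
    exact ⟨a, b', by rw [show g b' = b - h a from hb', add_sub_cancel]⟩
  obtain ⟨s, hs⟩ := hf
  have hiter : ∀ k b, ∃ a b', b = h a + g^[k] b' := by
    intro k
    induction k with
    | zero => exact fun b => ⟨0, b, by simp⟩
    | succ k ih =>
      intro b
      obtain ⟨a, b', rfl⟩ := hmod b
      obtain ⟨a', b'', rfl⟩ := ih b'
      refine ⟨a + f a', b'', ?_⟩
      rw [map_add, map_add, hh, Function.iterate_succ_apply', add_assoc]
  intro b
  obtain ⟨a, b', rfl⟩ := hiter s b
  exact ⟨a, by rw [iterate_eq_zero_of_algEquiv hs φ, add_zero]⟩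

/-- Finite-dimensional nilpotent Frobenius modules are determined by their envelopes. -/
theorem exists_equivariant_equiv [FiniteDimensional F A] (hf : ∃ s, ∀ x, f^[s] x = 0)
    (φ : Envelope f ≃ₐ[F] Envelope g) : ∃ e : A ≃ₗ[F] B, ∀ a, e (f a) = g (e a) := by
  obtain ⟨h, hh, hsurj⟩ := exists_surjective_equivariant hf φ
  have : FiniteDimensional F B := Module.Finite.of_surjective h hsurj
  obtain ⟨h', -, hsurj'⟩ := exists_surjective_equivariant (f := g) (g := f)
    (hf.imp fun s hs => iterate_eq_zero_of_algEquiv hs φ) φ.symm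
  have hdim : Module.finrank F A = Module.finrank F B :=
    le_antisymm (LinearMap.finrank_le_finrank_of_surjective hsurj')
      (LinearMap.finrank_le_finrank_of_surjective hsurj)
  have hinj : Function.Injective h :=
    (LinearMap.injective_iff_surjective_of_finrank_eq_finrank hdim).mpr hsurj
  exact ⟨LinearEquiv.ofBijective h ⟨hinj, hsurj⟩, hh⟩

end Comparison

end FrobeniusModule

namespace RestrictedLieAlgebra

section Quotient

variable (p : ℕ) (F L : Type*) [Field F] [LieRing L] [LieAlgebra F L] [RestrictedLieAlgebra p F L]

variable {L} in
theorem subset_restrictedClosure (S : Set L) : S ⊆ restrictedClosure p F S := fun x hx => by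
  rw [restrictedClosure, LieSubalgebra.coe_sInf]
  exact Set.mem_iInter₂.mpr fun K hK => hK.1 hx

variable {p F L} in
theorem restrictedClosure_le {S : Set L} {K : LieSubalgebra F L} (hS : S ⊆ K)
    (hK : ∀ x ∈ K, pmap p F L x ∈ K) : restrictedClosure p F S ≤ K :=
  sInf_le ⟨hS, hK⟩

variable {L} in
theorem pmap_mem_derivedP {x : L} (hx : x ∈ derivedP p F L) :
    pmap p F L x ∈ derivedP p F L := by
  change x ∈ (restrictedClosure p F (derivedSub F L : Set L) : Set L) at hx
  change _ ∈ (restrictedClosure p F (derivedSub F L : Set L) : Set L)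
  rw [restrictedClosure, LieSubalgebra.coe_sInf, Set.mem_iInter₂] at hx ⊢
  exact fun K hK => hK.2 x (hx K hK)

variable {L} in
theorem lie_mem_derivedP (x y : L) : ⁅x, y⁆ ∈ derivedP p F L := by
  refine subset_restrictedClosure p F _ ?_
  change _ ∈ LieModule.lowerCentralSeries F L L 1
  rw [LieModule.lowerCentralSeries_succ]
  exact LieSubmodule.lie_mem_lie (LieSubmodule.mem_top x) (LieSubmodule.mem_top y)

variable {F L} in
/-- The Lie algebra homomorphism into a commutative algebra given by a linear map which
vanishes on brackets. -/
def lieHomOfComm {T : Type*} [CommRing T] [Algebra F T] (θ : L →ₗ[F] T)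
    (hθ : ∀ x y : L, θ ⁅x, y⁆ = 0) : L →ₗ⁅F⁆ T :=
  { θ with map_lie' := fun {x y} => (hθ x y).trans (by rw [LieRing.of_associative_ring_bracket,
      mul_comm, sub_self]) }

variable {F L} in
@[simp]
theorem lieHomOfComm_apply {T : Type*} [CommRing T] [Algebra F T] (θ : L →ₗ[F] T)
    (hθ : ∀ x y : L, θ ⁅x, y⁆ = 0) (x : L) : lieHomOfComm θ hθ x = θ x := rfl

variable {L} in
theorem mk_lie (x y : L) : (derivedP p F L).mkQ ⁅x, y⁆ = 0 := by
  rw [Submodule.mkQ_apply, Submodule.Quotient.mk_eq_zero]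
  exact lie_mem_derivedP p F x y

variable [Fact p.Prime]

variable {L} in
theorem mk_pmap_add (x y : L) : (derivedP p F L).mkQ (pmap p F L (x + y)) =
    (derivedP p F L).mkQ (pmap p F L x) + (derivedP p F L).mkQ (pmap p F L y) := by
  rw [← sub_eq_zero, ← Module.forall_dual_apply_eq_zero_iff F]
  intro μ
  let θ : L →ₗ⁅F⁆ DualNumber F :=
    lieHomOfComm ((μ ∘ₗ (derivedP p F L).mkQ).smulRight DualNumber.eps) fun x y => by
      rw [LinearMap.smulRight_apply, LinearMap.comp_apply, mk_lie, map_zero, zero_smul]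
  have hθ : ∀ z, θ z = μ ((derivedP p F L).mkQ z) • DualNumber.eps := fun z => rfl
  have hpow : ∀ z, θ z ^ p = 0 := fun z => by
    refine pow_eq_zero_of_le (Fact.out : p.Prime).two_le ?_
    rw [hθ, sq, smul_mul_smul_comm, DualNumber.eps_mul_eps, smul_zero]
  have h := congrArg (UniversalEnvelopingAlgebra.lift F θ) (pOp_add (p := p) (F := F) x y)
  rw [← map_add (ι F)] at h
  simp only [map_sub, map_pow, UniversalEnvelopingAlgebra.lift_ι_apply, hpow, sub_zero] at h
  have h' := congrArg TrivSqZeroExt.snd h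
  simpa [hθ, sub_sub] using h'

variable [CharP F p]

/-- The `p`-map of `L / L'_p`, which is semilinear. -/
noncomputable def quotPMap : (L ⧸ derivedP p F L) →ₛₗ[frobenius F p] (L ⧸ derivedP p F L) :=
  (derivedP p F L).liftQ
    { toFun := fun x => (derivedP p F L).mkQ (pmap p F L x)
      map_add' := mk_pmap_add p F
      map_smul' := fun c x => by rw [pmap, pOp_smul, map_smul, frobenius_def] }
    fun x hx => (Submodule.Quotient.mk_eq_zero _).mpr (pmap_mem_derivedP p F hx)

variable {L} in
@[simp]
theorem quotPMap_mk (x : L) : quotPMap p F L ((derivedP p F L).mkQ x) =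
    (derivedP p F L).mkQ (pmap p F L x) := rfl

variable {p F L} in
theorem exists_quotPMap_iterate_eq_zero (hL : IsPNilpotent p F L) :
    ∃ s, ∀ x, (quotPMap p F L)^[s] x = 0 := by
  obtain ⟨s, hs⟩ := hL
  have hmem : ∀ k (x : L), (pmap p F L)^[k] x ∈ (subPPow p F)^[k] (⊤ : LieSubalgebra F L) := by
    intro k x
    induction k with
    | zero => trivial
    | succ k ih =>
      rw [Function.iterate_succ_apply', Function.iterate_succ_apply']
      exact subset_restrictedClosure p F _ ⟨_, ih, rfl⟩
  have hmk : ∀ k (x : L), (quotPMap p F L)^[k] ((derivedP p F L).mkQ x) =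
      (derivedP p F L).mkQ ((pmap p F L)^[k] x) := by
    intro k x
    induction k with
    | zero => rfl
    | succ k ih => rw [Function.iterate_succ_apply', ih, quotPMap_mk, Function.iterate_succ_apply']
  refine ⟨s, fun x => ?_⟩
  obtain ⟨x, rfl⟩ := (derivedP p F L).mkQ_surjective x
  have h := hmem s x
  rw [hs, LieSubalgebra.mem_bot] at h
  rw [hmk, h, map_zero]

end Quotient

section Abelianization

open FrobeniusModule

variable (p : ℕ) (F L : Type*) [Field F] [LieRing L] [LieAlgebra F L] [RestrictedLieAlgebra p F L]

variable {p F L} in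
theorem uEnv_hom_ext {T : Type*} [Ring T] [Algebra F T] {φ ψ : uEnv p F L →ₐ[F] T}
    (h : ∀ x, φ (uemb p F L x) = ψ (uemb p F L x)) : φ = ψ :=
  RingQuot.ringQuot_ext' F _ _ <| UniversalEnvelopingAlgebra.hom_ext F <| LieHom.ext h

variable {L} in
theorem uemb_pmap (x : L) : uemb p F L (pmap p F L x) = uemb p F L x ^ p := by
  change RingQuot.mkAlgHom F (uRel p F L) _ = RingQuot.mkAlgHom F (uRel p F L) _ ^ p
  rw [← map_pow]
  exact (RingQuot.mkAlgHom_rel F ⟨x, rfl, rfl⟩).symm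

variable {L} in
theorem uemb_lie (x y : L) : uemb p F L ⁅x, y⁆ =
    uemb p F L x * uemb p F L y - uemb p F L y * uemb p F L x := by
  change RingQuot.mkAlgHom F (uRel p F L) (ι F ⁅x, y⁆) = RingQuot.mkAlgHom F (uRel p F L) (ι F x) *
    RingQuot.mkAlgHom F (uRel p F L) (ι F y) - RingQuot.mkAlgHom F (uRel p F L) (ι F y) *
    RingQuot.mkAlgHom F (uRel p F L) (ι F x)
  rw [LieHom.map_lie, LieRing.of_associative_ring_bracket, map_sub, map_mul, map_mul]

variable [Fact p.Prime]

variable {p F L} in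
theorem derivedP_le_ker {T : Type*} [CommRing T] [Algebra F T] (ξ : uEnv p F L →ₐ[F] T) :
    derivedP p F L ≤ LinearMap.ker (ξ.toLinearMap ∘ₗ uemb p F L) := by
  have hlie : ∀ x y : L, (ξ.toLinearMap ∘ₗ uemb p F L) ⁅x, y⁆ = 0 := fun x y => by
    rw [LinearMap.comp_apply, AlgHom.toLinearMap_apply, uemb_lie, map_sub, map_mul, map_mul,
      mul_comm, sub_self]
  let K : LieSubalgebra F L :=
    { LinearMap.ker (ξ.toLinearMap ∘ₗ uemb p F L) with lie_mem' := fun {x y} _ _ => hlie x y }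
  have hK : ∀ x, x ∈ K ↔ ξ (uemb p F L x) = 0 := fun x => Iff.rfl
  refine restrictedClosure_le (K := K) ?_ fun x hx => ?_
  · change (LieModule.lowerCentralSeries F L L 1).toSubmodule ≤ K.toSubmodule
    rw [LieModule.lowerCentralSeries_succ, LieSubmodule.lieIdeal_oper_eq_linear_span']
    refine Submodule.span_le.mpr ?_
    rintro _ ⟨x, -, y, -, rfl⟩
    exact hlie x y
  · rw [hK] at hx ⊢
    rw [uemb_pmap, map_pow, hx, zero_pow (Fact.out : p.Prime).ne_zero]

variable [CharP F p]

/-- The map from `u(L)` to the commutative envelope of `L / L'_p`. -/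
noncomputable def toCommEnvelope : uEnv p F L →ₐ[F] Envelope (quotPMap p F L) :=
  RingQuot.liftAlgHom F
    ⟨UniversalEnvelopingAlgebra.lift F
      (lieHomOfComm (emb (quotPMap p F L) ∘ₗ (derivedP p F L).mkQ) fun x y => by
        rw [LinearMap.comp_apply, mk_lie, map_zero]), by
      rintro a b ⟨x, rfl, rfl⟩
      rw [map_pow, UniversalEnvelopingAlgebra.lift_ι_apply,
        UniversalEnvelopingAlgebra.lift_ι_apply, lieHomOfComm_apply, lieHomOfComm_apply,
        LinearMap.comp_apply, LinearMap.comp_apply, ← emb_map, quotPMap_mk]⟩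

variable {L} in
@[simp]
theorem toCommEnvelope_uemb (x : L) : toCommEnvelope p F L (uemb p F L x) =
    emb (quotPMap p F L) ((derivedP p F L).mkQ x) := by
  change RingQuot.liftAlgHom F _ (RingQuot.mkAlgHom F (uRel p F L) (ι F x)) = _
  rw [RingQuot.liftAlgHom_mkAlgHom_apply, UniversalEnvelopingAlgebra.lift_ι_apply]
  rfl

variable {p F L}

/-- Every homomorphism from `u(L)` to a commutative algebra factors through the envelope of
`L / L'_p`. -/
noncomputable def commEnvelopeLift {T : Type*} [CommRing T] [Algebra F T]
    (ξ : uEnv p F L →ₐ[F] T) : Envelope (quotPMap p F L) →ₐ[F] T :=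
  FrobeniusModule.lift (quotPMap p F L)
    ((derivedP p F L).liftQ (ξ.toLinearMap ∘ₗ uemb p F L) (derivedP_le_ker ξ)) fun x => by
      obtain ⟨x, rfl⟩ := (derivedP p F L).mkQ_surjective x
      rw [quotPMap_mk, Submodule.mkQ_apply, Submodule.mkQ_apply, Submodule.liftQ_apply,
        Submodule.liftQ_apply, LinearMap.comp_apply, LinearMap.comp_apply,
        AlgHom.toLinearMap_apply, AlgHom.toLinearMap_apply, uemb_pmap, map_pow]

theorem commEnvelopeLift_emb {T : Type*} [CommRing T] [Algebra F T]
    (ξ : uEnv p F L →ₐ[F] T) (x : L) :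
    commEnvelopeLift ξ (emb (quotPMap p F L) ((derivedP p F L).mkQ x)) = ξ (uemb p F L x) :=
  lift_emb _ _ _ _

theorem commEnvelopeLift_toCommEnvelope {T : Type*} [CommRing T] [Algebra F T]
    (ξ : uEnv p F L →ₐ[F] T) (r : uEnv p F L) :
    commEnvelopeLift ξ (toCommEnvelope p F L r) = ξ r :=
  AlgHom.congr_fun (φ₁ := (commEnvelopeLift ξ).comp (toCommEnvelope p F L))
    (uEnv_hom_ext fun x => by
      rw [AlgHom.comp_apply, toCommEnvelope_uemb, commEnvelopeLift_emb]) r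

variable {H : Type*} [LieRing H] [LieAlgebra F H] [RestrictedLieAlgebra p F H]

theorem commEnvelopeLift_comp_symm (φ : uEnv p F L ≃ₐ[F] uEnv p F H) :
    (commEnvelopeLift ((toCommEnvelope p F H).comp φ.toAlgHom)).comp
      (commEnvelopeLift ((toCommEnvelope p F L).comp φ.symm.toAlgHom)) = AlgHom.id F _ := by
  refine envelope_hom_ext _ fun x => ?_
  obtain ⟨x, rfl⟩ := (derivedP p F H).mkQ_surjective x
  rw [AlgHom.comp_apply, commEnvelopeLift_emb, AlgHom.comp_apply, commEnvelopeLift_toCommEnvelope,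
    AlgHom.comp_apply, AlgHom.id_apply, ← toCommEnvelope_uemb]
  exact congrArg _ (φ.apply_symm_apply _)

/-- An isomorphism of restricted enveloping algebras induces one of commutative envelopes. -/
noncomputable def commEnvelopeCongr (φ : uEnv p F L ≃ₐ[F] uEnv p F H) :
    Envelope (quotPMap p F L) ≃ₐ[F] Envelope (quotPMap p F H) :=
  AlgEquiv.ofAlgHom (commEnvelopeLift ((toCommEnvelope p F H).comp φ.toAlgHom))
    (commEnvelopeLift ((toCommEnvelope p F L).comp φ.symm.toAlgHom))
    (commEnvelopeLift_comp_symm φ) (commEnvelopeLift_comp_symm φ.symm)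

end Abelianization

end RestrictedLieAlgebra

open RestrictedLieAlgebra in
/-- If `L` is a finite-dimensional `p`-nilpotent restricted Lie algebra over a perfect
field `F` of characteristic `p > 0` and `H` is a restricted Lie algebra with
`u(L) ≅ u(H)`, then `L/L'_p ≅ H/H'_p` as restricted Lie algebras. -/
theorem quotient_derivedP_determined
    (p : ℕ) (F L H : Type*) [Field F] [Fact p.Prime] [CharP F p] [PerfectField F]
    [LieRing L] [LieAlgebra F L] [RestrictedLieAlgebra p F L]
    [LieRing H] [LieAlgebra F H] [RestrictedLieAlgebra p F H]
    [FiniteDimensional F L] (hL : IsPNilpotent p F L)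
    (hiso : Nonempty (uEnv p F L ≃ₐ[F] uEnv p F H)) :
    ∃ e : (L ⧸ derivedP p F L) ≃ₗ[F] (H ⧸ derivedP p F H),
      ∀ (x x' : L) (y y' : H),
        e (Submodule.Quotient.mk x) = Submodule.Quotient.mk y →
        e (Submodule.Quotient.mk x') = Submodule.Quotient.mk y' →
        e (Submodule.Quotient.mk ⁅x, x'⁆) = Submodule.Quotient.mk ⁅y, y'⁆ ∧
        e (Submodule.Quotient.mk (pmap p F L x)) = Submodule.Quotient.mk (pmap p F H y) := by
  obtain ⟨φ⟩ := hiso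
  obtain ⟨e, he⟩ := FrobeniusModule.exists_equivariant_equiv
    (exists_quotPMap_iterate_eq_zero hL) (commEnvelopeCongr φ)
  refine ⟨e, fun x x' y y' hxy _ => ⟨?_, ?_⟩⟩
  · rw [(Submodule.Quotient.mk_eq_zero _).mpr (lie_mem_derivedP p F x x'),
      (Submodule.Quotient.mk_eq_zero _).mpr (lie_mem_derivedP p F y y'), map_zero]
  · have h := he (Submodule.Quotient.mk x)
    rw [hxy] at h
    exact h
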